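/- For every natural number n, any unital C*-algebra in the class WD_n has nuclear dimension at most 2ⁿ − 1. -/

import Mathlib

universe u

/-- `a ∈_ε S`: there is `s ∈ S` with `‖a - s‖ < ε`. -/
def MemEps {A : Type u} [CStarAlgebra A] (ε : ℝ) (S : Set A) (a : A) : Prop :=
  ∃ s ∈ S, ‖a - s‖ < ε

/-- A unital C*-algebra `A` weakly decomposes over a class `𝒞` of C*-subalgebras of `A`
(Definition 2.14 of the paper). -/
def WeakDecomposes (A : Type u) [CStarAlgebra A]
    (𝒞 : NonUnitalStarSubalgebra ℂ A → Prop) : Prop :=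
  ∀ (X : Finset A) (ε : ℝ), 0 < ε →
    ∃ C D : NonUnitalStarSubalgebra ℂ A, 𝒞 C ∧ 𝒞 D ∧
      ∃ h : A, (∃ x : A, h = star x * x) ∧ ‖h‖ ≤ 1 ∧
        (∀ x ∈ X, ‖h * x - x * h‖ < ε) ∧
        (∀ x ∈ X, MemEps ε (C : Set A) (h * x)) ∧
        (∀ x ∈ X, MemEps ε (D : Set A) ((1 - h) * x))

/-- A unital C*-algebra is locally finite-dimensional. -/
def IsLocFinDim (A : Type u) [CStarAlgebra A] : Prop :=
  ∀ (X : Finset A) (ε : ℝ), 0 < ε →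
    ∃ F : NonUnitalStarSubalgebra ℂ A, FiniteDimensional ℂ F ∧
      ∀ x ∈ X, MemEps ε (F : Set A) x

/-- The C*-subalgebra `S` of `A` is *-isomorphic to the C*-algebra `B`. -/
def SubIso {A : Type u} [CStarAlgebra A] (S : NonUnitalStarSubalgebra ℂ A)
    (B : Type u) [CStarAlgebra B] : Prop :=
  Nonempty (S ≃⋆ₐ[ℂ] B)

/-- Membership in the class `WD_α` of the weak complexity hierarchy (Definition 2.15 of the
paper): `WD₀` consists of the unital locally finite-dimensional C*-algebras, and for
`α > 0`, `WD_α` consists of the unital C*-algebras weakly decomposing over the class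
`⋃_{β<α} WD_β`. -/
def InWD (α : Ordinal.{u}) (A : Type u) [CStarAlgebra A] : Prop :=
  (α = 0 ∧ IsLocFinDim A) ∨
  (α ≠ 0 ∧ WeakDecomposes A fun S =>
      IsClosed (S : Set A) ∧
      ∃ β : {b : Ordinal.{u} // b < α}, ∃ (B : Type u) (instB : CStarAlgebra B),
        @InWD β.1 B instB ∧ @SubIso A _ S B instB)
termination_by α
decreasing_by exact β.2
universe v
/-- A square matrix over a C*-algebra (or star ring) is positive iff it has the form
`star y * y`. -/
def MatIsPos {R : Type*} [NonUnitalSemiring R] [StarRing R] {k : ℕ}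
    (x : Matrix (Fin k) (Fin k) R) : Prop :=
  ∃ y : Matrix (Fin k) (Fin k) R, x = star y * y

/-- A ℂ-linear map between C*-algebras is completely positive if, for every `k`, the induced
map on `k × k` matrices maps positive matrices to positive matrices. -/
def IsCP {A : Type u} {B : Type v} [NonUnitalCStarAlgebra A] [NonUnitalCStarAlgebra B]
    (φ : A →ₗ[ℂ] B) : Prop :=
  ∀ (k : ℕ) (x : Matrix (Fin k) (Fin k) A), MatIsPos x → MatIsPos (x.map φ)

/-- The data witnessing one instance of the nuclear dimension condition: a finite-dimensional
C*-algebra `F = F₀ ⊕ ⋯ ⊕ F_n` (modeled as a finite product), a contractive completely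
positive map `ψ : A → F`, and a completely positive map `φ : F → A` whose restriction to each
summand is contractive and order zero, with `φ ∘ ψ` `ε`-approximating the identity on `X`. -/
def NucDimWitness (A : Type u) [NonUnitalCStarAlgebra A] (n : ℕ) (X : Finset A) (ε : ℝ)
    (F : Fin (n + 1) → Type v) [∀ i, NonUnitalCStarAlgebra (F i)] : Prop :=
  (∀ i, FiniteDimensional ℂ (F i)) ∧
  ∃ (ψ : A →ₗ[ℂ] (∀ i, F i)) (φ : (∀ i, F i) →ₗ[ℂ] A),
    IsCP ψ ∧ (∀ a : A, ‖ψ a‖ ≤ ‖a‖) ∧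
    IsCP φ ∧
    (∀ i : Fin (n + 1),
      (∀ x : F i, ‖φ (Pi.single i x)‖ ≤ ‖x‖) ∧
      (∀ x y : F i, (∃ u, x = star u * u) → (∃ v, y = star v * v) → x * y = 0 →
        φ (Pi.single i x) * φ (Pi.single i y) = 0)) ∧
    (∀ x ∈ X, ‖φ (ψ x) - x‖ < ε)

/-- A C*-algebra `A` has nuclear dimension at most `n`. -/
def NuclearDimLE (n : ℕ) (A : Type u) [NonUnitalCStarAlgebra A] : Prop :=
  ∀ (X : Finset A) (ε : ℝ), 0 < ε →
    ∃ (F : Fin (n + 1) → Type) (instF : ∀ i, NonUnitalCStarAlgebra (F i)),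
      @NucDimWitness A _ n X ε F instF

universe w

section
open scoped CStarAlgebra

lemma exists_star_mul_self_add {R : Type*} [NonUnitalCStarAlgebra R] (a b : R) :
    ∃ c : R, star a * a + star b * b = star c * c := by
  let _ := CStarAlgebra.spectralOrder R
  have _ := CStarAlgebra.spectralOrderedRing R
  exact CStarAlgebra.nonneg_iff_eq_star_mul_self.mp
    (add_nonneg (star_mul_self_nonneg _) (star_mul_self_nonneg _))

/-- Sums of positive matrices are positive. -/
lemma MatIsPos.add' {B : Type*} [NonUnitalCStarAlgebra B] {k : ℕ}
    {x y : Matrix (Fin k) (Fin k) B} (hx : MatIsPos x) (hy : MatIsPos y) : MatIsPos (x + y) := by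
  let _ := CStarAlgebra.spectralOrder B
  have _ := CStarAlgebra.spectralOrderedRing B
  obtain ⟨a, rfl⟩ := hx
  obtain ⟨b, rfl⟩ := hy
  obtain ⟨c, hc⟩ := exists_star_mul_self_add (R := CStarMatrix (Fin k) (Fin k) B)
    (CStarMatrix.ofMatrix a) (CStarMatrix.ofMatrix b)
  exact ⟨CStarMatrix.ofMatrix.symm c, hc⟩

lemma MatIsPos.zero' {B : Type*} [NonUnitalCStarAlgebra B] {k : ℕ} :
    MatIsPos (0 : Matrix (Fin k) (Fin k) B) := ⟨0, by simp⟩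

lemma MatIsPos.sum' {B : Type*} [NonUnitalCStarAlgebra B] {k : ℕ} {ι : Type*} (s : Finset ι)
    (x : ι → Matrix (Fin k) (Fin k) B) (h : ∀ i ∈ s, MatIsPos (x i)) :
    MatIsPos (∑ i ∈ s, x i) := by
  classical
  induction s using Finset.induction_on with
  | empty => simpa using MatIsPos.zero'
  | insert a s ha ih =>
    rw [Finset.sum_insert ha]
    exact (h a (by simp)).add' (ih fun i hi => h i (by simp [hi]))

/-- Gram matrices of a single row. -/
lemma MatIsPos.row {B : Type*} [NonUnitalCStarAlgebra B] {k : ℕ} (W : Fin k → B) :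
    MatIsPos (Matrix.of fun i j => star (W i) * W j) := by
  rcases k with _ | k
  · exact ⟨0, Subsingleton.elim _ _⟩
  · refine ⟨Matrix.of fun r i => if r = 0 then W i else 0, ?_⟩
    ext i j
    simp [Matrix.mul_apply, Matrix.star_apply, apply_ite star]

lemma MatIsPos.rows {B : Type*} [NonUnitalCStarAlgebra B] {k : ℕ} {ι : Type*} (s : Finset ι)
    (W : ι → Fin k → B) :
    MatIsPos (Matrix.of fun i j => ∑ r ∈ s, star (W r i) * W r j) := by
  have := MatIsPos.sum' s (fun r => Matrix.of fun i j => star (W r i) * W r j)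
    (fun r _ => MatIsPos.row _)
  convert this using 1
  ext i j
  simp [Matrix.sum_apply]

/-- cp maps: Gram matrix criterion -/
lemma isCP_of_gram {A : Type u} {B : Type v} [NonUnitalCStarAlgebra A] [NonUnitalCStarAlgebra B]
    (φ : A →ₗ[ℂ] B)
    (h : ∀ (k : ℕ) (y : Fin k → A), MatIsPos (Matrix.of fun i j => φ (star (y i) * y j))) :
    IsCP φ := by
  rintro k _ ⟨y, rfl⟩
  have := MatIsPos.sum' Finset.univ (fun r => Matrix.of fun i j => φ (star (y r i) * y r j))
    (fun r _ => h k _)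
  convert this using 1
  ext i j
  simp [Matrix.sum_apply, Matrix.mul_apply, Matrix.star_apply]

lemma isCP_starHom {A : Type u} {B : Type v} [NonUnitalCStarAlgebra A] [NonUnitalCStarAlgebra B]
    (f : A →⋆ₙₐ[ℂ] B) : IsCP (f : A →ₗ[ℂ] B) := by
  rintro k _ ⟨y, rfl⟩
  refine ⟨y.map f, ?_⟩
  ext i j
  simp [Matrix.mul_apply, Matrix.star_apply]
  simp only [← map_star]

lemma IsCP.comp' {A : Type u} {B : Type v} {C : Type w} [NonUnitalCStarAlgebra A]
    [NonUnitalCStarAlgebra B] [NonUnitalCStarAlgebra C] {φ : B →ₗ[ℂ] C} {ψ : A →ₗ[ℂ] B}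
    (hφ : IsCP φ) (hψ : IsCP ψ) : IsCP (φ ∘ₗ ψ) := by
  intro k x hx
  have := hφ k _ (hψ k x hx)
  rwa [Matrix.map_map] at this

lemma IsCP.sum' {A : Type u} {B : Type v} [NonUnitalCStarAlgebra A]
    [NonUnitalCStarAlgebra B] {ι : Type*} (s : Finset ι) (φ : ι → A →ₗ[ℂ] B)
    (h : ∀ i ∈ s, IsCP (φ i)) : IsCP (∑ i ∈ s, φ i) := by
  intro k x hx
  convert MatIsPos.sum' s (fun i => x.map (φ i)) (fun i hi => h i hi k x hx) using 1
  ext i j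
  simp [Matrix.sum_apply]

lemma isCP_zero {A : Type u} {B : Type v} [NonUnitalCStarAlgebra A]
    [NonUnitalCStarAlgebra B] : IsCP (0 : A →ₗ[ℂ] B) := by
  intro k x hx
  convert MatIsPos.zero' (B := B) (k := k) using 1
  ext i j; simp

/-- the compression `a ↦ k a k` for self-adjoint `k`. -/
noncomputable def compr {A : Type u} [CStarAlgebra A] (k : A) : A →ₗ[ℂ] A :=
  (LinearMap.mulLeft ℂ k) ∘ₗ (LinearMap.mulRight ℂ k)

lemma compr_apply {A : Type u} [CStarAlgebra A] (k a : A) : compr k a = k * (a * k) := rfl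

lemma isCP_compr {A : Type u} [CStarAlgebra A] (k : A) (hk : star k = k) : IsCP (compr k) := by
  apply isCP_of_gram
  intro n y
  convert MatIsPos.row (fun i => y i * k) using 1
  ext i j
  simp [compr_apply, hk, mul_assoc]

lemma isCP_pi {A : Type u} [NonUnitalCStarAlgebra A] {ι : Type*} [Fintype ι] {F : ι → Type v}
    [∀ i, NonUnitalCStarAlgebra (F i)] (ψ : ∀ i, A →ₗ[ℂ] F i) (h : ∀ i, IsCP (ψ i)) :
    IsCP (LinearMap.pi ψ) := by
  intro k x hx
  choose y hy using fun i => h i k x hx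
  refine ⟨Matrix.of fun a b i => y i a b, ?_⟩
  ext a b i
  have := congrFun (congrFun (hy i) a) b
  simpa [Matrix.mul_apply, Matrix.star_apply] using this

lemma isCP_proj {ι : Type*} [Fintype ι] {F : ι → Type v}
    [∀ i, NonUnitalCStarAlgebra (F i)] (i : ι) :
    IsCP (LinearMap.proj i : (∀ i, F i) →ₗ[ℂ] F i) := by
  rintro k _ ⟨y, rfl⟩
  refine ⟨y.map (fun z => z i), ?_⟩
  ext a b
  simp [Matrix.mul_apply, Matrix.star_apply]

/-- A 2-positive map with `‖φ 1‖ ≤ 1` is contractive. -/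
lemma IsCP.contractive {A : Type u} {B : Type v} [CStarAlgebra A] [NonUnitalCStarAlgebra B]
    {φ : A →ₗ[ℂ] B} (hφ : IsCP φ) (h1 : ‖φ 1‖ ≤ 1) (a : A) : ‖φ a‖ ≤ ‖a‖ := by
  let _ := CStarAlgebra.spectralOrder A
  have _ := CStarAlgebra.spectralOrderedRing A
  let _ := CStarAlgebra.spectralOrder B
  have _ := CStarAlgebra.spectralOrderedRing B
  have hpos : ∀ a : A, 0 ≤ a → 0 ≤ φ a := by
    intro a ha
    obtain ⟨b, rfl⟩ := CStarAlgebra.nonneg_iff_eq_star_mul_self.mp ha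
    obtain ⟨y, hy⟩ := hφ 1 _ (MatIsPos.row (fun _ => b))
    have := congrFun (congrFun hy 0) 0
    simp [Matrix.mul_apply, Matrix.star_apply] at this
    rw [this]; exact star_mul_self_nonneg _
  have haa : ‖φ (star a * a)‖ ≤ ‖a‖ ^ 2 := by
    have h2 : star a * a ≤ algebraMap ℝ A (‖a‖ ^ 2) := by
      have := IsSelfAdjoint.le_algebraMap_norm_self (IsSelfAdjoint.star_mul_self a)
      rwa [CStarRing.norm_star_mul_self, ← sq] at this
    have h3 := hpos _ (sub_nonneg.mpr h2)
    rw [map_sub, sub_nonneg] at h3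
    have h4 : φ (algebraMap ℝ A (‖a‖ ^ 2)) = ((‖a‖ ^ 2 : ℝ) : ℂ) • φ 1 := by
      rw [← map_smul]; congr 1
      rw [Algebra.algebraMap_eq_smul_one]
      exact (RCLike.real_smul_eq_coe_smul (K := ℂ) _ _)
    have h5 := CStarAlgebra.norm_le_norm_of_nonneg_of_le (hpos _ (star_mul_self_nonneg a)) h3
    rw [h4, norm_smul] at h5
    refine h5.trans ?_
    simp only [Complex.norm_real, norm_pow, norm_norm]
    nlinarith [norm_nonneg a, sq_nonneg ‖a‖]
  obtain ⟨y, hy⟩ := hφ 2 _ (MatIsPos.row (![1, a]))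
  have e1 := congrFun (congrFun hy 0) 0
  have e2 := congrFun (congrFun hy 0) 1
  have e3 := congrFun (congrFun hy 1) 1
  simp [Matrix.mul_apply, Matrix.star_apply] at e1 e2 e3
  let v : WithCStarModule B (Fin 2 → B) := WithCStarModule.equiv _ _ |>.symm (fun r => star (y r 0))
  let w : WithCStarModule B (Fin 2 → B) := WithCStarModule.equiv _ _ |>.symm (fun r => star (y r 1))
  have hvw : inner B w v = φ a := by
    rw [e2]; simp [WithCStarModule.pi_inner, v, w, WithCStarModule.inner_def]
  have hvv : inner B v v = φ 1 := by
    rw [e1]; simp [WithCStarModule.pi_inner, v, WithCStarModule.inner_def]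
  have hww : inner B w w = φ (star a * a) := by
    rw [e3]; simp [WithCStarModule.pi_inner, w, WithCStarModule.inner_def]
  have hn : ‖inner B w v‖ ≤ ‖w‖ * ‖v‖ := CStarModule.norm_inner_le (A := B) _
  have hv2 : ‖v‖ ^ 2 = ‖inner B v v‖ := CStarModule.norm_sq_eq B
  have hw2 : ‖w‖ ^ 2 = ‖inner B w w‖ := CStarModule.norm_sq_eq B
  rw [hvw] at hn
  rw [hvv] at hv2
  rw [hww] at hw2
  have hv1 : ‖v‖ ≤ 1 := by
    rw [← hv2] at h1; exact (sq_le_one_iff₀ (norm_nonneg _)).mp h1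
  have hw1 : ‖w‖ ≤ ‖a‖ := by
    rw [← hw2] at haa; exact (sq_le_sq₀ (norm_nonneg _) (norm_nonneg _)).mp haa
  calc ‖φ a‖ ≤ ‖v‖ * ‖w‖ := by rw [mul_comm]; exact hn
    _ ≤ 1 * ‖a‖ := by gcongr
    _ = _ := one_mul _
end

section
open scoped ComplexOrder

lemma exists_orthonormal_basis_core {V : Type*} [AddCommGroup V] [Module ℂ V]
    [FiniteDimensional ℂ V] (c : InnerProductSpace.Core ℂ V) :
    ∃ (N : ℕ) (b : Fin N → V), (∀ x : V, x = ∑ i, c.inner (b i) x • b i) ∧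
      ∀ f : V →ₗ[ℂ] V, LinearMap.trace ℂ V f = ∑ i, c.inner (b i) (f (b i)) := by
  let _ := c.toNormedAddCommGroup
  let _ := InnerProductSpace.ofCore c.toCore
  let b := stdOrthonormalBasis ℂ V
  refine ⟨_, b, fun x => (b.sum_repr' x).symm, fun f => ?_⟩
  exact LinearMap.trace_eq_sum_inner f b

/-- hermitian from positivity of the diagonal -/
lemma herm_of_real {R : Type*} [NonUnitalRing R] [StarRing R] [Module ℂ R] [StarModule ℂ R]
    [IsScalarTower ℂ R R] [SMulCommClass ℂ R R]
    (τ : R →ₗ[ℂ] ℂ) (h : ∀ x, (τ (star x * x)).im = 0) (x y : R) :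
    star (τ (star y * x)) = τ (star x * y) := by
  have h1 := h (x + y)
  have h2 := h (x + Complex.I • y)
  have hx := h x
  have hy := h y
  simp only [star_add, star_smul, add_mul, mul_add, smul_mul_assoc, mul_smul_comm, map_add,
    map_smul, smul_eq_mul, Complex.add_im, Complex.star_def, Complex.conj_I, Complex.mul_im,
    Complex.I_re, Complex.I_im, Complex.mul_re, Complex.neg_re, Complex.neg_im] at h1 h2
  apply Complex.ext
  · simp; linarith
  · simp; linarith

/-- the trace of the left regular representation -/
noncomputable def regTr (F : Type*) [NonUnitalRing F] [Module ℂ F] [IsScalarTower ℂ F F]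
    [SMulCommClass ℂ F F] : F →ₗ[ℂ] ℂ := LinearMap.trace ℂ F ∘ₗ LinearMap.mul ℂ F

lemma regTr_apply {F : Type*} [NonUnitalRing F] [Module ℂ F] [IsScalarTower ℂ F F]
    [SMulCommClass ℂ F F] (x : F) : regTr F x = LinearMap.trace ℂ F (LinearMap.mul ℂ F x) := rfl

lemma regTr_mul {F : Type*} [NonUnitalRing F] [Module ℂ F] [IsScalarTower ℂ F F]
    [SMulCommClass ℂ F F] (x y : F) : regTr F (x * y) = regTr F (y * x) := by
  have h : ∀ x y : F, LinearMap.mul ℂ F (x * y) = LinearMap.mul ℂ F x * LinearMap.mul ℂ F y := by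
    intro x y; ext z; simp [mul_assoc]
  rw [regTr_apply, regTr_apply, h, h, LinearMap.trace_mul_comm]

lemma eig_nonneg {F : Type*} [NonUnitalCStarAlgebra F] (x y : F) (hy : y ≠ 0) (l : ℂ)
    (h : star x * x * y = l • y) : 0 ≤ l := by
  let _ := CStarAlgebra.spectralOrder F
  have _ := CStarAlgebra.spectralOrderedRing F
  set q := star y * y with hq
  set p := star (x * y) * (x * y) with hp
  have e : p = l • q := by
    rw [hp, hq, ← mul_smul_comm, ← h, star_mul]; simp [mul_assoc]
  have hq0 : 0 ≤ q := star_mul_self_nonneg _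
  have hp0 : 0 ≤ p := star_mul_self_nonneg _
  have hqne : q ≠ 0 := by simpa [hq] using hy
  -- `l` is real
  have hsa : star l • q = l • q := by
    have := congrArg star e
    rw [star_smul, (IsSelfAdjoint.of_nonneg hq0).star_eq, (IsSelfAdjoint.of_nonneg hp0).star_eq,
      e] at this
    exact this.symm
  have hl : star l = l := smul_left_injective ℂ hqne hsa
  obtain ⟨r, rfl⟩ : ∃ r : ℝ, (r : ℂ) = l := by
    exact Complex.conj_eq_iff_real.mp hl |>.imp fun _ h => h.symm
  by_contra hneg
  have hr : r < 0 := by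
    by_contra h'; exact hneg (by exact_mod_cast not_lt.mp h')
  have h3 : 0 ≤ (-r) • q := smul_nonneg (by linarith) hq0
  have h4 : (-r) • q = -p := by
    rw [e, neg_smul]; congr 1
  rw [h4] at h3
  have h5 : p = 0 := le_antisymm (by simpa using h3) hp0
  rw [h5] at e
  have := (smul_eq_zero.mp e.symm).resolve_right hqne
  norm_cast at this; linarith

lemma regTr_pos {F : Type*} [NonUnitalCStarAlgebra F] [FiniteDimensional ℂ F] (x : F) :
    0 ≤ regTr F (star x * x) ∧ (regTr F (star x * x) = 0 → x = 0) := by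
  set L := LinearMap.mul ℂ F (star x * x) with hL
  have hsp : L.charpoly.Splits := IsAlgClosed.splits _
  have htr : regTr F (star x * x) = L.charpoly.roots.sum :=
    Module.End.trace_eq_sum_roots_charpoly_of_splits hsp
  have hroot : ∀ l ∈ L.charpoly.roots, 0 ≤ l := by
    intro l hl
    have : Module.End.HasEigenvalue L l := by
      rw [Module.End.hasEigenvalue_iff_isRoot_charpoly]
      exact (Polynomial.mem_roots'.mp hl).2
    obtain ⟨y, hy⟩ := this.exists_hasEigenvector
    exact eig_nonneg x y hy.2 l (by simpa [hL] using hy.apply_eq_smul)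
  refine ⟨htr ▸ Multiset.sum_nonneg hroot, fun h0 => ?_⟩
  rw [htr] at h0
  have hz : ∀ l ∈ L.charpoly.roots, l = 0 := by
    intro l hl
    exact le_antisymm (h0 ▸ Multiset.single_le_sum hroot l hl) (hroot l hl)
  have hchar : L.charpoly = Polynomial.X ^ (L.charpoly.roots.card) := by
    conv_lhs => rw [hsp.eq_prod_roots_of_monic (LinearMap.charpoly_monic L)]
    rw [Multiset.map_congr (g := fun _ => Polynomial.X) rfl
      (fun l hl => by rw [hz l hl, map_zero, sub_zero])]
    simp
  have hnil : L ^ (L.charpoly.roots.card) = 0 := by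
    have := LinearMap.aeval_self_charpoly L
    rwa [hchar, map_pow, Polynomial.aeval_X] at this
  have hLL : ∀ v, L (L v) = 0 → L v = 0 := by
    intro v hv
    rw [← CStarRing.star_mul_self_eq_zero_iff]
    have h1 : star (L v) * (L v) = star v * L (L v) := by simp [hL, mul_assoc]
    rw [h1, hv, mul_zero]
  have hpow : ∀ (n : ℕ) (v : F), (L ^ n) v = 0 → L v = 0 := by
    intro n
    induction n with
    | zero => intro v hv; simp at hv; simp [hv]
    | succ n ih =>
      intro v hv
      rw [pow_succ, Module.End.mul_apply] at hv
      exact hLL v (ih _ hv)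
  have h2 : L (star x) = 0 := hpow _ _ (by rw [hnil]; rfl)
  have h3 : x * star x = 0 := by
    rw [← CStarRing.star_mul_self_eq_zero_iff]
    have : star (x * star x) * (x * star x) = x * L (star x) := by simp [hL, mul_assoc]
    rw [this, h2, mul_zero]
  exact (CStarRing.mul_star_self_eq_zero_iff x).mp h3

theorem finDim_frame (F : Type*) [NonUnitalCStarAlgebra F] [FiniteDimensional ℂ F] :
    ∃ (N : ℕ) (b : Fin N → F) (τ : F →ₗ[ℂ] ℂ) (e : F),
      (∀ x, 0 ≤ τ (star x * x)) ∧ (∀ x, e * x = x) ∧ (∀ x, x * e = x) ∧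
      ∀ x, ∑ i, ∑ j, τ (star (b i) * x * b j) • (b i * star (b j)) = x := by
  let τ := regTr F
  have hherm : ∀ x y, star (τ (star y * x)) = τ (star x * y) :=
    herm_of_real τ fun x => (Complex.nonneg_iff.mp (regTr_pos x).1).2.symm
  let c : InnerProductSpace.Core ℂ F :=
    { inner := fun x y => τ (star x * y)
      conj_inner_symm := fun x y => hherm x y
      re_inner_nonneg := fun x => (Complex.nonneg_iff.mp (regTr_pos x).1).1
      add_left := fun x y z => by simp [add_mul]
      smul_left := fun x y r => by simp [smul_mul_assoc]
      definite := fun x h => (regTr_pos x).2 h }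
  obtain ⟨N, b, hb, htr⟩ := exists_orthonormal_basis_core c
  have hb' : ∀ x, ∑ i, τ (star (b i) * x) • b i = x := fun x => (hb x).symm
  have htr' : ∀ x, τ x = ∑ i, τ (star (b i) * (x * b i)) := fun x => htr (LinearMap.mul ℂ F x)
  set z := ∑ i, b i * star (b i) with hz
  have hτz : ∀ x, τ (x * z) = τ x := by
    intro x
    rw [htr' x, hz, Finset.mul_sum, map_sum]
    refine Finset.sum_congr rfl fun i _ => ?_
    rw [← mul_assoc]
    exact regTr_mul _ _
  have hzl : ∀ y, z * y = y := by
    intro y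
    rw [← sub_eq_zero]
    apply (regTr_pos _).2
    change τ _ = 0
    generalize star (z * y - y) = x
    rw [mul_sub, map_sub, sub_eq_zero, ← mul_assoc]
    have h1 : τ (x * z * y) = τ (y * x * z) := by rw [mul_assoc y]; exact regTr_mul _ _
    rw [h1, hτz]; exact regTr_mul _ _
  have hzs : star z = z := by simp [hz, star_sum]
  have hzr : ∀ y, y * z = y := by
    intro y
    have := congrArg star (hzl (star y))
    simpa [hzs] using this
  refine ⟨N, b, τ, z, fun x => (regTr_pos x).1, hzl, hzr, fun x => ?_⟩
  rw [Finset.sum_comm]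
  have : ∀ j, ∑ i, τ (star (b i) * x * b j) • (b i * star (b j)) = x * b j * star (b j) := by
    intro j
    conv_rhs => rw [← hb' (x * b j), Finset.sum_mul]
    simp [mul_assoc, smul_mul_assoc]
  simp_rw [this, mul_assoc, ← Finset.mul_sum]
  exact hzr x
end

section
open scoped ComplexOrder

/-- An injective *-homomorphism reflects positivity. -/
lemma reflect_pos {A : Type u} {B : Type v} [CStarAlgebra A] [NonUnitalCStarAlgebra B]
    (ι : B →⋆ₙₐ[ℂ] A) (hι : Function.Injective ι) (c : B) (hc : star c = c)
    (h : ∃ y : A, ι c = star y * y) : ∃ y : B, c = star y * y := by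
  let _ := CStarAlgebra.spectralOrder A
  have _ := CStarAlgebra.spectralOrderedRing A
  let _ := CStarAlgebra.spectralOrder B
  have _ := CStarAlgebra.spectralOrderedRing B
  have hsa : IsSelfAdjoint c := hc
  rw [← CStarAlgebra.nonneg_iff_eq_star_mul_self] at h ⊢
  rw [← CFC.negPart_eq_zero_iff c]
  set n := c⁻ with hn
  have hn0 : 0 ≤ n := CFC.negPart_nonneg c
  have hns : star n = n := (IsSelfAdjoint.of_nonneg hn0).star_eq
  have hcn : n * c * n = - (n * n * n) := by
    have h1 : c = c⁺ - c⁻ := (CFC.posPart_sub_negPart c).symm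
    have h2 : c⁻ * c⁺ = 0 := CFC.negPart_mul_posPart c
    calc n * c * n = n * (c⁺ - c⁻) * n := by rw [← h1]
      _ = _ := by rw [mul_sub, h2]; simp [hn]
  have h1 : 0 ≤ star (ι n) * ι c * ι n := star_left_conjugate_nonneg h _
  have h2 : 0 ≤ star n * n * n := star_left_conjugate_nonneg hn0 n
  rw [hns] at h2
  have h3 : 0 ≤ ι (n * n * n) := by
    obtain ⟨y, hy⟩ := CStarAlgebra.nonneg_iff_eq_star_mul_self.mp h2
    rw [hy, map_mul, map_star]; exact star_mul_self_nonneg _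
  have h4 : ι (n * n * n) = 0 := by
    refine le_antisymm ?_ h3
    rw [← map_star, hns, ← map_mul, ← map_mul, hcn, map_neg] at h1
    simpa using h1
  have h5 : n * n * n = 0 := hι (by rw [h4, map_zero])
  have h6 : star (n * n) * (n * n) = 0 := by
    rw [star_mul, hns, ← mul_assoc, h5, zero_mul]
  rw [CStarRing.star_mul_self_eq_zero_iff] at h6
  rw [← CStarRing.star_mul_self_eq_zero_iff, hns, h6]

lemma extend_functional {A : Type u} {B : Type v} [CStarAlgebra A] [NonUnitalCStarAlgebra B]
    (ι : B →⋆ₙₐ[ℂ] A) (hι : Function.Injective ι) (e : B) (hel : ∀ b, e * b = b)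
    (her : ∀ b, b * e = b) (s : B →ₗ[ℂ] ℂ) (hs : ∀ y, 0 ≤ s (star y * y)) :
    ∃ t : A →ₗ[ℂ] ℂ, (∀ y, 0 ≤ t (star y * y)) ∧ (∀ b, t (ι b) = s b) ∧
      ∀ a, t a = t (ι e * a * ι e) := by
  let _ := CStarAlgebra.spectralOrder A
  have _ := CStarAlgebra.spectralOrderedRing A
  have hes : star e = e := by
    have := congrArg star (hel (star e))
    rw [star_mul, star_star, hel] at this
    exact this
  set p := ι e with hp
  have hps : star p = p := by rw [hp, ← map_star, hes]
  have hpι : ∀ b, p * ι b * p = ι b := by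
    intro b; rw [hp, ← map_mul, ← map_mul, hel, her]
  have hpp : p * p = p := by rw [hp, ← map_mul, hel]
  have hsh : ∀ b, s (star b) = star (s b) := by
    intro b
    have := herm_of_real s (fun x => (Complex.nonneg_iff.mp (hs x)).2.symm) b e
    rw [hes, hel, her] at this
    exact this.symm
  let K : PointedCone ℝ A :=
    { carrier := {a | 0 ≤ p * (a + star a) * p}
      zero_mem' := by simp
      add_mem' := by
        intro a b ha hb
        simp only [Set.mem_ofPred_eq] at *
        have : p * (a + b + star (a + b)) * p = p * (a + star a) * p + p * (b + star b) * p := by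
          rw [star_add]; noncomm_ring
        rw [this]; exact add_nonneg ha hb
      smul_mem' := by
        rintro ⟨c, hc⟩ a ha
        simp only [Set.mem_ofPred_eq] at *
        have : p * ((⟨c, hc⟩ : {c : ℝ // 0 ≤ c}) • a + star ((⟨c, hc⟩ : {c : ℝ // 0 ≤ c}) • a)) * p
            = c • (p * (a + star a) * p) := by
          change p * (c • a + star (c • a)) * p = _
          rw [star_smul]; simp [mul_add, add_mul]
        rw [this]; exact smul_nonneg hc ha }
  have hK : ∀ a, a ∈ K ↔ 0 ≤ p * (a + star a) * p := fun a => Iff.rfl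
  let ιR : B →ₗ[ℝ] A := (ι : B →ₗ[ℂ] A).restrictScalars ℝ
  have hιR : ∀ b, ιR b = ι b := fun b => rfl
  let eq := LinearEquiv.ofInjective ιR hι
  let f0 : B →ₗ[ℝ] ℝ := Complex.reLm ∘ₗ (s.restrictScalars ℝ)
  have hf0 : ∀ b, f0 b = (s b).re := fun b => rfl
  let f : A →ₗ.[ℝ] ℝ := ⟨LinearMap.range ιR, f0 ∘ₗ eq.symm.toLinearMap⟩
  have hf : ∀ b, f ⟨ιR b, LinearMap.mem_range_self _ b⟩ = (s b).re := by
    intro b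
    change f0 (eq.symm _) = _
    have : eq b = ⟨ιR b, LinearMap.mem_range_self _ b⟩ := rfl
    rw [← this, LinearEquiv.symm_apply_apply]; rfl
  obtain ⟨g, hg1, hg2⟩ := riesz_extension K f (by
    rintro ⟨_, b, rfl⟩ hb
    rw [hf]
    replace hb : ιR b ∈ K := hb
    rw [hK, hιR, ← map_star, ← map_add, hpι] at hb
    obtain ⟨y, hy⟩ := reflect_pos ι hι (b + star b) (by simp [add_comm])
      (CStarAlgebra.nonneg_iff_eq_star_mul_self.mp hb)
    have h1 := (Complex.nonneg_iff.mp (hs y)).1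
    rw [← hy, map_add, hsh] at h1
    simp at h1; exact h1) (by
    intro y
    set r := ‖y + star y‖ with hr
    refine ⟨⟨ιR (r • e), LinearMap.mem_range_self _ _⟩, ?_⟩
    rw [hK]
    have hw : IsSelfAdjoint (y + star y) := IsSelfAdjoint.add_star_self y
    have h1 : 0 ≤ y + star y + algebraMap ℝ A r := by
      have := hw.neg_algebraMap_norm_le_self
      rw [← hr] at this
      rw [← neg_le_iff_add_nonneg]; exact this
    have h2 := star_left_conjugate_nonneg h1 p
    have h3 : ιR (r • e) = r • p := map_smul _ _ _
    have h4 : 0 ≤ r • p := smul_nonneg (norm_nonneg _) (by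
      have := star_mul_self_nonneg p
      rwa [hps, hpp] at this)
    have h5 : p * ((ιR (r • e)) + y + star ((ιR (r • e)) + y)) * p
        = star p * (y + star y + algebraMap ℝ A r) * p + r • p := by
      rw [h3, hps, star_add, star_smul, hps, Algebra.algebraMap_eq_smul_one]
      simp only [mul_add, add_mul, mul_smul_comm, smul_mul_assoc, hpp, mul_one, star_trivial]
      abel
    rw [h5]
    exact add_nonneg h2 h4)
  have hgι : ∀ b, g (ι b) = (s b).re := by
    intro b; rw [← hf, ← hg1]; rfl
  have hg0 : ∀ a, p * (a + star a) * p = 0 → g a = 0 := by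
    intro a ha
    have h1 := hg2 a (by rw [hK, ha])
    have h2 := hg2 (-a) (by
      rw [hK]
      have : p * (-a + star (-a)) * p = - (p * (a + star a) * p) := by
        rw [star_neg]; noncomm_ring
      rw [this, ha, neg_zero])
    rw [map_neg] at h2
    linarith
  let t : A →ₗ[ℂ] ℂ := Module.Dual.extendRCLike (𝕜 := ℂ) g
  have ht : ∀ a, t a = (g a : ℂ) - Complex.I * (g (Complex.I • a) : ℂ) := by
    intro a
    exact Module.Dual.extendRCLike_apply (𝕜 := ℂ) g a
  refine ⟨t, fun y => ?_, fun b => ?_, fun a => ?_⟩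
  · have h1 : g (Complex.I • (star y * y)) = 0 := by
      apply hg0; simp
    rw [ht, h1]
    simp only [Complex.ofReal_zero, mul_zero, sub_zero]
    have : 0 ≤ g (star y * y) := by
      apply hg2
      rw [hK]
      have h2 := star_left_conjugate_nonneg
        (add_nonneg (star_mul_self_nonneg y) (star_mul_self_nonneg y)) p
      rw [hps] at h2
      simpa using h2
    exact_mod_cast this
  · rw [ht, ← map_smul, hgι, hgι]
    apply Complex.ext <;> simp
  · have key : ∀ a, g a = g (p * a * p) := by
      intro a
      rw [← sub_eq_zero, ← map_sub]
      apply hg0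
      have h1 : p * (a - p * a * p + star (a - p * a * p)) * p =
        p * a * p - (p * p) * a * (p * p) + p * star a * p - (p * p) * star a * (p * p) := by
        simp only [star_sub, star_mul, hps]; noncomm_ring
      rw [h1, hpp]; abel
    rw [ht, ht, key a, key (Complex.I • a)]
    simp
end

section
open scoped ComplexOrder

lemma extend_family {A : Type u} {B : Type v} [CStarAlgebra A] [NonUnitalCStarAlgebra B]
    (ι : B →⋆ₙₐ[ℂ] A) (hι : Function.Injective ι) (e : B) (hel : ∀ b, e * b = b)
    (her : ∀ b, b * e = b) {N : ℕ} (S : Fin N → Fin N → B →ₗ[ℂ] ℂ)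
    (hS : ∀ x : Matrix (Fin N) (Fin N) B, MatIsPos x → 0 ≤ ∑ i, ∑ j, S i j (x i j)) :
    ∃ T : Fin N → Fin N → A →ₗ[ℂ] ℂ,
      (∀ m : Fin N → A, 0 ≤ ∑ i, ∑ j, T i j (star (m i) * m j)) ∧
      (∀ i j b, T i j (ι b) = S i j b) ∧ (∀ i j, T i j 1 = S i j e) := by
  classical
  let _ := CStarAlgebra.spectralOrder A
  have _ := CStarAlgebra.spectralOrderedRing A
  let _ := CStarAlgebra.spectralOrder B
  have _ := CStarAlgebra.spectralOrderedRing B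
  let ιN : CStarMatrix (Fin N) (Fin N) B →⋆ₙₐ[ℂ] CStarMatrix (Fin N) (Fin N) A :=
    CStarMatrix.mapₙₐ ι
  have hιN : ∀ x i j, ιN x i j = ι (x i j) := fun x i j => rfl
  let eN : CStarMatrix (Fin N) (Fin N) B := CStarMatrix.ofMatrix (Matrix.diagonal fun _ => e)
  let s : CStarMatrix (Fin N) (Fin N) B →ₗ[ℂ] ℂ :=
    { toFun := fun x => ∑ i, ∑ j, S i j (x i j)
      map_add' := fun x y => by simp [Finset.sum_add_distrib]
      map_smul' := fun c x => by simp [Finset.mul_sum] }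
  have hs : ∀ x, s x = ∑ i, ∑ j, S i j (x i j) := fun x => rfl
  let sg : Fin N → Fin N → A → CStarMatrix (Fin N) (Fin N) A :=
    fun i j a => CStarMatrix.ofMatrix (Matrix.single i j a)
  have hsg : ∀ i j a k l, sg i j a k l = if i = k ∧ j = l then a else 0 := by
    intro i j a k l; exact Matrix.single_apply ..
  obtain ⟨t, ht1, ht2, ht3⟩ := extend_functional ιN
    (fun x y hxy => by
      ext i j
      have := congrFun (congrFun hxy i) j
      exact hι this)
    eN (fun x => by
      have h : (Matrix.diagonal fun _ => e) * (CStarMatrix.ofMatrix.symm x)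
          = CStarMatrix.ofMatrix.symm x := by
        ext i j
        rw [Matrix.diagonal_mul, hel]
      exact h)
    (fun x => by
      have h : (CStarMatrix.ofMatrix.symm x) * (Matrix.diagonal fun _ => e)
          = CStarMatrix.ofMatrix.symm x := by
        ext i j
        rw [Matrix.mul_diagonal, her]
      exact h) s
    (fun y => hS _ ⟨CStarMatrix.ofMatrix.symm y, rfl⟩)
  let T : Fin N → Fin N → A →ₗ[ℂ] ℂ := fun i j =>
    { toFun := fun a => t (sg i j a)
      map_add' := fun a b => by
        rw [← map_add]; congr 1; exact Matrix.single_add ..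
      map_smul' := fun c a => by
        rw [RingHom.id_apply, ← map_smul]; congr 1; exact (Matrix.smul_single ..).symm }
  have hT : ∀ i j a, T i j a = t (sg i j a) := fun i j a => rfl
  have hTsum : ∀ x : CStarMatrix (Fin N) (Fin N) A, t x = ∑ i, ∑ j, T i j (x i j) := by
    intro x
    simp only [hT, ← map_sum]
    congr 1
    exact Matrix.matrix_eq_sum_single (CStarMatrix.ofMatrix.symm x)
  have hTι : ∀ i j b, T i j (ι b) = S i j b := by
    intro i j b
    have h1 : sg i j (ι b) = ιN (CStarMatrix.ofMatrix (Matrix.single i j b)) := by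
      ext k l
      rw [hsg, hιN, CStarMatrix.ofMatrix_apply, Matrix.single_apply]
      split_ifs <;> simp
    rw [hT, h1, ht2, hs]
    rw [Finset.sum_eq_single i, Finset.sum_eq_single j]
    · simp [CStarMatrix.ofMatrix_apply]
    · intro l _ hl; simp [CStarMatrix.ofMatrix_apply, hl.symm]
    · simp
    · intro k _ hk; simp [CStarMatrix.ofMatrix_apply, hk.symm]
    · simp
  refine ⟨T, fun m => ?_, hTι, fun i j => ?_⟩
  · rcases N with _ | N
    · simp
    · have := ht1 (CStarMatrix.ofMatrix (Matrix.of fun r i => if r = 0 then m i else 0))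
      rw [hTsum] at this
      convert this using 6 with i _ j _
      rw [CStarMatrix.mul_apply]
      simp [CStarMatrix.star_apply, CStarMatrix.ofMatrix_apply, apply_ite star]
  · rw [← hTι, hT, hT, ht3]
    congr 1
    have h0 : ιN eN = CStarMatrix.ofMatrix (Matrix.diagonal fun _ => ι e) := by
      ext k l
      rw [hιN]
      simp only [eN, CStarMatrix.ofMatrix_apply, Matrix.diagonal_apply]
      split_ifs <;> simp
    rw [h0]
    have h : (Matrix.diagonal fun _ => ι e) * (Matrix.single i j 1 : Matrix (Fin N) (Fin N) A) *
        (Matrix.diagonal fun _ => ι e) = Matrix.single i j (ι e) := by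
      ext k l
      rw [Matrix.mul_diagonal, Matrix.diagonal_mul, Matrix.single_apply, Matrix.single_apply]
      split_ifs
      · rw [mul_one, ← map_mul, hel]
      · simp
    exact h

open scoped MatrixOrder in
open Matrix in
lemma exists_factor {n : Type*} [Fintype n] [DecidableEq n] (G : Matrix n n ℂ)
    (h : ∀ c : n → ℂ, 0 ≤ star c ⬝ᵥ (G.mulVec c)) : ∃ Z : Matrix n n ℂ, G = Zᴴ * Z := by
  have hH : G.IsHermitian := by
    rw [Matrix.isHermitian_iff_isSymmetric, LinearMap.isSymmetric_iff_inner_map_self_real]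
    intro v
    have h1 : inner ℂ v (Matrix.toEuclideanLin G v) = star v.ofLp ⬝ᵥ (G *ᵥ v.ofLp) := by
      rw [EuclideanSpace.inner_eq_star_dotProduct, Matrix.ofLp_toEuclideanLin_apply,
        dotProduct_comm]
    rw [inner_conj_symm, h1, ← inner_conj_symm, h1]
    exact (Complex.conj_eq_iff_im.mpr (Complex.nonneg_iff.mp (h _)).2.symm).symm
  have hG : G.PosSemidef := Matrix.PosSemidef.of_dotProduct_mulVec_nonneg hH h
  exact CStarAlgebra.nonneg_iff_eq_star_mul_self.mp hG.nonneg

/-- Arveson extension into finite-dimensional C*-algebras. -/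
theorem arveson {A : Type u} {B : Type v} {F : Type w} [CStarAlgebra A] [NonUnitalCStarAlgebra B]
    [NonUnitalCStarAlgebra F] [FiniteDimensional ℂ F]
    (ι : B →⋆ₙₐ[ℂ] A) (hι : Function.Injective ι) (e : B) (hel : ∀ b, e * b = b)
    (her : ∀ b, b * e = b) (ψ : B →ₗ[ℂ] F) (hψ : IsCP ψ) (hψ1 : ∀ b, ‖ψ b‖ ≤ ‖b‖) :
    ∃ θ : A →ₗ[ℂ] F, IsCP θ ∧ (∀ a, ‖θ a‖ ≤ ‖a‖) ∧ ∀ b, θ (ι b) = ψ b := by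
  obtain ⟨N, b, τ, -, hτ, -, -, hfr⟩ := finDim_frame F
  let S : Fin N → Fin N → B →ₗ[ℂ] ℂ := fun i j =>
    τ ∘ₗ (LinearMap.mulLeft ℂ (star (b i))) ∘ₗ (LinearMap.mulRight ℂ (b j)) ∘ₗ ψ
  have hSa : ∀ i j x, S i j x = τ (star (b i) * ψ x * b j) := by
    intro i j x; simp [S, mul_assoc]
  obtain ⟨T, hT1, hT2, hT3⟩ := extend_family ι hι e hel her S (by
    intro x hx
    obtain ⟨y, hy⟩ := hψ N x hx
    have h1 : ∀ i j, ψ (x i j) = ∑ r, star (y r i) * y r j := by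
      intro i j
      have := congrFun (congrFun hy i) j
      simpa [Matrix.mul_apply, Matrix.star_apply] using this
    have h2 : ∑ i, ∑ j, S i j (x i j)
        = ∑ r, τ (star (∑ i, y r i * b i) * (∑ j, y r j * b j)) := by
      have h3 : ∀ i j, S i j (x i j) = ∑ r, τ (star (y r i * b i) * (y r j * b j)) := by
        intro i j
        rw [hSa, h1, Finset.mul_sum, Finset.sum_mul, map_sum]
        simp only [star_mul, mul_assoc]
      have h4 : ∀ r, τ (star (∑ i, y r i * b i) * (∑ j, y r j * b j))
          = ∑ i, ∑ j, τ (star (y r i * b i) * (y r j * b j)) := by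
        intro r
        rw [star_sum, Finset.sum_mul_sum]
        simp only [map_sum]
      simp only [h3, h4]
      rw [Finset.sum_comm]
      conv_lhs => enter [2, j]; rw [Finset.sum_comm]
      rw [Finset.sum_comm]
      refine Finset.sum_congr rfl fun r _ => ?_
      rw [Finset.sum_comm]
    rw [h2]
    exact Finset.sum_nonneg fun r _ => hτ _)
  let θ : A →ₗ[ℂ] F := ∑ i, ∑ j, (T i j).smulRight (b i * star (b j))
  have hθ : ∀ a, θ a = ∑ i, ∑ j, T i j a • (b i * star (b j)) := by
    intro a; simp [θ, LinearMap.sum_apply]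
  have hθι : ∀ x, θ (ι x) = ψ x := by
    intro x; rw [hθ]; simp only [hT2, hSa, hfr]
  have hθ1 : θ 1 = ψ e := by
    rw [hθ]; simp only [hT3, hSa, hfr]
  have hcp : IsCP θ := by
    apply isCP_of_gram
    intro k y
    let G : Matrix (Fin k × Fin N) (Fin k × Fin N) ℂ :=
      Matrix.of fun p q => T p.2 q.2 (star (y p.1) * y q.1)
    have hG0 : ∀ c : Fin k × Fin N → ℂ, 0 ≤ dotProduct (star c) (G.mulVec c) := by
      intro c
      have h1 := hT1 (fun i => ∑ p, c (p, i) • y p)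
      have h2 : ∀ i j, T i j (star (∑ p, c (p, i) • y p) * ∑ p, c (p, j) • y p) =
          ∑ p, ∑ q, star (c (p, i)) * (G (p, i) (q, j) * c (q, j)) := by
        intro i j
        rw [star_sum, Finset.sum_mul_sum, map_sum]
        refine Finset.sum_congr rfl fun p _ => ?_
        rw [map_sum]
        refine Finset.sum_congr rfl fun q _ => ?_
        rw [star_smul, smul_mul_smul_comm, map_smul]
        simp only [G, Matrix.of_apply, smul_eq_mul]
        ring
      simp only [h2] at h1
      convert h1 using 1
      simp only [dotProduct, Matrix.mulVec, Finset.mul_sum, Pi.star_apply]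
      rw [Fintype.sum_prod_type]
      simp only [Fintype.sum_prod_type]
      rw [Finset.sum_comm]
      refine Finset.sum_congr rfl fun i _ => ?_
      conv_lhs => enter [2, p]; rw [Finset.sum_comm]
      rw [Finset.sum_comm]
    obtain ⟨Z, hZ⟩ : ∃ Z : Matrix (Fin k × Fin N) (Fin k × Fin N) ℂ, G = Z.conjTranspose * Z :=
      exists_factor G hG0
    convert MatIsPos.rows Finset.univ
      (fun (r : Fin k × Fin N) (l : Fin k) => ∑ j, Z r (l, j) • star (b j)) using 1
    ext p q
    have hZ' : ∀ i j, T i j (star (y p) * y q) = ∑ r, star (Z r (p, i)) * Z r (q, j) := by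
      intro i j
      have := congrFun (congrFun hZ (p, i)) (q, j)
      simpa [G, Matrix.mul_apply, Matrix.conjTranspose_apply] using this
    simp only [Matrix.of_apply, hθ, hZ', star_sum, star_smul, star_star, Finset.sum_mul_sum,
      smul_mul_smul_comm, Finset.sum_smul]
    conv_rhs => rw [Finset.sum_comm]
    refine Finset.sum_congr rfl fun i _ => ?_
    rw [Finset.sum_comm]
  refine ⟨θ, hcp, fun a => hcp.contractive ?_ a, hθι⟩
  rw [hθ1]
  refine (hψ1 e).trans ?_
  have h1 : ‖e‖ = ‖e‖ * ‖e‖ := by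
    rw [← CStarRing.norm_star_mul_self, her, norm_star]
  by_contra hlt
  nlinarith [not_le.mp hlt]
end

section
open scoped ComplexOrder

/-- One summand of a nuclear dimension approximation. -/
structure NPiece (A : Type u) [CStarAlgebra A] where
  F : Type
  inst : NonUnitalCStarAlgebra F
  fin : FiniteDimensional ℂ F
  ψ : A →ₗ[ℂ] F
  φ : F →ₗ[ℂ] A
  ψcp : IsCP ψ
  ψc : ∀ a, ‖ψ a‖ ≤ ‖a‖
  φcp : IsCP φ
  φc : ∀ x, ‖φ x‖ ≤ ‖x‖
  oz : ∀ x y : F, (∃ u, x = star u * u) → (∃ v, y = star v * v) → x * y = 0 → φ x * φ y = 0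

/-- The composite map of a piece. -/
noncomputable def NPiece.app {A : Type u} [CStarAlgebra A] (P : NPiece A) (x : A) : A := P.φ (P.ψ x)

/-- Approximation of the identity by sums of `n` pieces. -/
def PD (n : ℕ) (A : Type u) [CStarAlgebra A] : Prop :=
  ∀ (X : Finset A) (ε : ℝ), 0 < ε → ∃ P : Fin n → NPiece A,
    ∀ x ∈ X, ‖∑ i, (P i).app x - x‖ < ε

lemma PD.nuclearDimLE {n : ℕ} {A : Type u} [CStarAlgebra A] (h : PD (n + 1) A) :
    NuclearDimLE n A := by
  classical
  intro X ε hε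
  obtain ⟨P, hP⟩ := h X ε hε
  let inst : ∀ i, NonUnitalCStarAlgebra (P i).F := fun i => (P i).inst
  refine ⟨fun i => (P i).F, inst, fun i => (P i).fin, LinearMap.pi fun i => (P i).ψ,
    ∑ i, (P i).φ ∘ₗ LinearMap.proj i, isCP_pi _ fun i => (P i).ψcp, fun a => ?_,
    IsCP.sum' _ _ fun i _ => IsCP.comp' (P i).φcp (isCP_proj i), fun i => ?_, fun x hx => ?_⟩
  · exact (pi_norm_le_iff_of_nonneg (norm_nonneg _)).2 fun i => (P i).ψc a
  · have key : ∀ x : (P i).F, (∑ j, (P j).φ ∘ₗ LinearMap.proj j) (Pi.single i x) = (P i).φ x := by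
      intro x
      rw [LinearMap.sum_apply, Finset.sum_eq_single i]
      · simp
      · intro j _ hj
        simp [Pi.single_eq_of_ne hj]
      · simp
    refine ⟨fun x => ?_, fun x y hx hy hxy => ?_⟩
    · rw [key]; exact (P i).φc x
    · rw [key, key]; exact (P i).oz x y hx hy hxy
  · have := hP x hx
    simpa [LinearMap.sum_apply, NPiece.app] using this

/-- The zero piece. -/
noncomputable def zeroPiece (A : Type u) [CStarAlgebra A] : NPiece A where
  F := ℂ
  inst := inferInstance
  fin := inferInstance
  ψ := 0
  φ := 0
  ψcp := isCP_zero
  ψc := by simp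
  φcp := isCP_zero
  φc := by simp
  oz := by simp

lemma PD.mono {m n : ℕ} {A : Type u} [CStarAlgebra A] (h : PD m A) (hmn : m ≤ n) : PD n A := by
  obtain ⟨k, rfl⟩ := Nat.exists_eq_add_of_le hmn
  intro X ε hε
  obtain ⟨P, hP⟩ := h X ε hε
  refine ⟨Fin.append P fun _ => zeroPiece A, fun x hx => ?_⟩
  rw [Fin.sum_univ_add]
  simp only [Fin.append_left, Fin.append_right]
  have : ∀ x : A, (zeroPiece A).app x = 0 := fun x => rfl
  simpa [this] using hP x hx

lemma transport_cstar {B : Type u} [NonUnitalCStarAlgebra B] (T : Type) (e : T ≃ B) :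
    ∃ (_ : NonUnitalCStarAlgebra T) (f : T →⋆ₙₐ[ℂ] B), Function.Bijective f := by
  let : NonUnitalRing T := e.nonUnitalRing
  let : Module ℂ T := e.module ℂ
  let : Star T := ⟨fun x => e.symm (star (e x))⟩
  have hs : ∀ x : T, e (star x) = star (e x) := fun x => e.apply_symm_apply _
  have ha : ∀ x y : T, e (x + y) = e x + e y := fun x y => e.apply_symm_apply _
  have hm : ∀ x y : T, e (x * y) = e x * e y := fun x y => e.apply_symm_apply _
  have h0 : e (0 : T) = 0 := e.apply_symm_apply _
  have hc : ∀ (c : ℂ) (x : T), e (c • x) = c • e x := fun c x => e.apply_symm_apply _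
  let : StarRing T :=
    { star_involutive := fun x => e.injective (by rw [hs, hs, star_star])
      star_mul := fun x y => e.injective (by rw [hs, hm, hm, hs, hs, star_mul])
      star_add := fun x y => e.injective (by rw [hs, ha, ha, hs, hs, star_add]) }
  let f : T →⋆ₙₐ[ℂ] B :=
    { toFun := e, map_add' := ha, map_mul' := hm, map_zero' := h0, map_smul' := hc
      map_star' := hs }
  let : NonUnitalNormedRing T := NonUnitalNormedRing.induced T B f e.injective
  let : NormedSpace ℂ T := NormedSpace.induced ℂ T B (f : T →ₗ[ℂ] B)
  have hn : ∀ x : T, ‖x‖ = ‖e x‖ := fun x => rfl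
  have hiso : Isometry e := AddMonoidHomClass.isometry_of_norm f fun x => rfl
  have : CompleteSpace T := by
    rw [completeSpace_iff_isComplete_range hiso.isUniformInducing, e.surjective.range_eq]
    exact isComplete_univ
  have : CStarRing T := ⟨fun x => by
    rw [hn, hn, hm, hs]; exact CStarRing.norm_mul_self_le _⟩
  have : IsScalarTower ℂ T T := ⟨fun c x y => e.injective (by
    simp only [smul_eq_mul, hc, hm, smul_mul_assoc])⟩
  have : SMulCommClass ℂ T T := ⟨fun c x y => e.injective (by
    simp only [smul_eq_mul, hc, hm, mul_smul_comm])⟩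
  have : StarModule ℂ T := ⟨fun c x => e.injective (by
    simp only [hs, hc, star_smul])⟩
  exact ⟨{}, f, e.bijective⟩

lemma PD_of_isLocFinDim {A : Type u} [CStarAlgebra A] (h : IsLocFinDim A) : PD 1 A := by
  intro X ε hε
  obtain ⟨S, hS, hX⟩ := h X (ε / 2) (by positivity)
  have := hS
  have : CompleteSpace S := FiniteDimensional.complete ℂ S
  have : CStarRing S := ⟨fun x => CStarRing.norm_mul_self_le (x : A)⟩
  let : NonUnitalCStarAlgebra S := {}
  let d := Module.finrank ℂ S
  let e : (Fin d → ℂ) ≃ S := ((Module.finBasis ℂ S).equivFun.symm).toEquiv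
  obtain ⟨T, ⟨eT⟩⟩ : ∃ T : Type, Nonempty (T ≃ S) := ⟨_, ⟨e⟩⟩
  obtain ⟨instT, f, hf⟩ := transport_cstar T eT
  have : FiniteDimensional ℂ T :=
    FiniteDimensional.of_injective ((f : T →ₙₐ[ℂ] S) : T →ₗ[ℂ] S) hf.1
  let ι : T →⋆ₙₐ[ℂ] A := (NonUnitalStarSubalgebraClass.subtype S).comp f
  have hι : Function.Injective ι := Subtype.val_injective.comp hf.1
  obtain ⟨_, _, _, u, -, hul, hur, -⟩ := finDim_frame T
  obtain ⟨θ, hθ, hθc, hθe⟩ := arveson ι hι u hul hur (LinearMap.id : T →ₗ[ℂ] T)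
    (fun k x hx => by simpa using hx) (fun b => le_rfl)
  have hn : ∀ x, ‖ι x‖ = ‖x‖ := fun x => NonUnitalStarAlgHom.norm_map ι hι x
  refine ⟨fun _ => { F := T, inst := instT, fin := inferInstance, ψ := θ, φ := (ι : T →ₗ[ℂ] A)
                     ψcp := hθ, ψc := hθc, φcp := isCP_starHom ι, φc := fun x => (hn x).le
                     oz := fun x y _ _ hxy => ?_ }, fun x hx => ?_⟩
  · change ι x * ι y = 0
    rw [← map_mul, hxy, map_zero]
  · obtain ⟨s, hs, hxs⟩ := hX x hx
    obtain ⟨t, ht⟩ := hf.2 ⟨s, hs⟩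
    have hts : ι t = s := congrArg Subtype.val ht
    rw [Fin.sum_univ_one]
    change ‖ι (θ x) - x‖ < ε
    have h1 : ι (θ x) - x = ι (θ (x - s)) - (x - s) := by
      rw [map_sub θ, map_sub ι, ← hts, hθe]; simp
    rw [h1]
    calc _ ≤ ‖ι (θ (x - s))‖ + ‖x - s‖ := norm_sub_le _ _
      _ ≤ ‖x - s‖ + ‖x - s‖ := by rw [hn]; gcongr; exact hθc _
      _ < ε := by linarith
end

section
open scoped ComplexOrder

lemma norm_mul_pow_le_aux {A : Type u} [CStarAlgebra A] (h : A) (hh : ‖h‖ ≤ 1) (y : A) (n : ℕ) :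
    ‖y * h ^ n‖ ≤ ‖y‖ := by
  induction n with
  | zero => simp
  | succ n ih =>
    rw [pow_succ, ← mul_assoc]
    calc _ ≤ ‖y * h ^ n‖ * ‖h‖ := norm_mul_le _ _
      _ ≤ ‖y * h ^ n‖ * 1 := by gcongr
      _ ≤ ‖y‖ := by rw [mul_one]; exact ih

lemma pow_comm_aux {A : Type u} [CStarAlgebra A] (h : A) (hh : ‖h‖ ≤ 1) (x : A) (n : ℕ) :
    ‖h ^ n * x - x * h ^ n‖ ≤ n * ‖h * x - x * h‖ := by
  induction n with
  | zero => simp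
  | succ n ih =>
    have : h ^ (n + 1) * x - x * h ^ (n + 1)
        = h * (h ^ n * x - x * h ^ n) + (h * x - x * h) * h ^ n := by
      rw [pow_succ']; noncomm_ring
    rw [this]
    calc _ ≤ ‖h * (h ^ n * x - x * h ^ n)‖ + ‖(h * x - x * h) * h ^ n‖ := norm_add_le _ _
      _ ≤ 1 * (n * ‖h * x - x * h‖) + ‖h * x - x * h‖ := by
        gcongr
        · exact (norm_mul_le _ _).trans (by gcongr)
        · exact norm_mul_pow_le_aux h hh _ n
      _ = _ := by push_cast; ring

lemma poly_comm_aux (A : Type u) [CStarAlgebra A] (p : Polynomial ℝ) :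
    ∃ C : ℝ, 0 ≤ C ∧ ∀ h : A, ‖h‖ ≤ 1 → ∀ x : A,
      ‖Polynomial.aeval h p * x - x * Polynomial.aeval h p‖ ≤ C * ‖h * x - x * h‖ := by
  induction p using Polynomial.induction_on' with
  | add p q hp hq =>
    obtain ⟨C, hC, hp⟩ := hp
    obtain ⟨D, hD, hq⟩ := hq
    refine ⟨C + D, by positivity, fun h hh x => ?_⟩
    have : Polynomial.aeval h (p + q) * x - x * Polynomial.aeval h (p + q)
      = (Polynomial.aeval h p * x - x * Polynomial.aeval h p)
        + (Polynomial.aeval h q * x - x * Polynomial.aeval h q) := by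
      rw [map_add]; noncomm_ring
    rw [this, add_mul]
    exact (norm_add_le _ _).trans (add_le_add (hp h hh x) (hq h hh x))
  | monomial n a =>
    refine ⟨‖a‖ * n, by positivity, fun h hh x => ?_⟩
    rw [Polynomial.aeval_monomial, ← Algebra.smul_def, smul_mul_assoc, mul_smul_comm, ← smul_sub,
      norm_smul, mul_assoc]
    gcongr
    exact pow_comm_aux h hh x n

lemma sqrt_comm_aux (A : Type u) [CStarAlgebra A] (M η : ℝ) (hM : 0 ≤ M) (hη : 0 < η) :
    ∃ δ : ℝ, 0 < δ ∧ ∀ h : A, (∃ y : A, h = star y * y) → ‖h‖ ≤ 1 →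
      ∃ k : A, star k = k ∧ k * k = h ∧ ‖k‖ ≤ 1 ∧ ∀ x : A, ‖x‖ ≤ M →
        ‖h * x - x * h‖ < δ → ‖k * x - x * k‖ < η := by
  let _ := CStarAlgebra.spectralOrder A
  have _ := CStarAlgebra.spectralOrderedRing A
  set ε := η / (4 * (M + 1)) with hε
  have hεp : 0 < ε := by positivity
  obtain ⟨p, hp⟩ := exists_polynomial_near_of_continuousOn 0 1 Real.sqrt
    Real.continuous_sqrt.continuousOn ε hεp
  obtain ⟨C, hC, hpC⟩ := poly_comm_aux A p
  refine ⟨η / (2 * (C + 1)), by positivity, fun h hpos hh => ?_⟩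
  have h0 : 0 ≤ h := by obtain ⟨y, rfl⟩ := hpos; exact star_mul_self_nonneg y
  have hsa : IsSelfAdjoint h := h0.isSelfAdjoint
  have hle : h ≤ 1 := (CStarAlgebra.norm_le_one_iff_of_nonneg h h0).1 hh
  have hspec : ∀ t ∈ spectrum ℝ h, t ∈ Set.Icc (0:ℝ) 1 := by
    intro t ht
    refine ⟨spectrum_nonneg_of_nonneg h0 ht, ?_⟩
    have := (le_algebraMap_iff_spectrum_le (R := ℝ) (a := h) (r := 1)).1 (by simpa using hle)
    exact this t ht
  have hkk : cfc Real.sqrt h * cfc Real.sqrt h = h := by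
    rw [← cfc_mul ..]
    conv_rhs => rw [← cfc_id ℝ h]
    exact cfc_congr fun t ht => Real.mul_self_sqrt (hspec t ht).1
  refine ⟨cfc Real.sqrt h, cfc_predicate (p := IsSelfAdjoint) Real.sqrt h, hkk, ?_,
    fun x hx hc => ?_⟩
  · refine norm_cfc_le zero_le_one fun t ht => ?_
    rw [Real.norm_of_nonneg (Real.sqrt_nonneg _)]
    exact Real.sqrt_le_one.2 (hspec t ht).2
  · set k := cfc Real.sqrt h
    set q := Polynomial.aeval h p with hq
    have hkq : ‖q - k‖ ≤ ε := by
      rw [hq, ← cfc_polynomial p h hsa, ← cfc_sub ..]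
      exact norm_cfc_le hεp.le fun t ht => (hp t (hspec t ht)).le
    have : k * x - x * k = (q * x - x * q) - ((q - k) * x - x * (q - k)) := by noncomm_ring
    rw [this]
    have e1 : ‖(q - k) * x‖ ≤ ε * M := (norm_mul_le _ _).trans (by gcongr)
    have e2 : ‖x * (q - k)‖ ≤ M * ε := (norm_mul_le _ _).trans (by gcongr)
    have e3 : ‖q * x - x * q‖ ≤ η / 2 := by
      refine (hpC h hh x).trans ?_
      calc C * ‖h * x - x * h‖ ≤ (C + 1) * (η / (2 * (C + 1))) := by gcongr; linarith
        _ = η / 2 := by field_simp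
    have e4 : ε * (M + 1) = η / 4 := by rw [hε]; field_simp
    calc _ ≤ ‖q * x - x * q‖ + (‖(q - k) * x‖ + ‖x * (q - k)‖) :=
          (norm_sub_le _ _).trans (by gcongr; exact norm_sub_le _ _)
      _ ≤ η / 2 + (ε * M + M * ε) := by gcongr
      _ < η := by nlinarith
end

section
open scoped ComplexOrder

lemma NPiece.push {A : Type u} {B : Type v} [CStarAlgebra A] [CStarAlgebra B]
    (ι : B →⋆ₙₐ[ℂ] A) (hι : Function.Injective ι) (k : A) (hk : star k = k) (hk1 : ‖k‖ ≤ 1)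
    (Q : NPiece B) : ∃ (P : NPiece A) (L : A →ₗ[ℂ] A), (∀ a, ‖L a‖ ≤ ‖a‖) ∧
      (∀ a, P.app a = L (k * (a * k))) ∧ ∀ b, L (ι b) = ι (Q.app b) := by
  let _ := Q.inst
  have _ := Q.fin
  obtain ⟨θ, hθ, hθc, hθe⟩ := arveson ι hι 1 one_mul mul_one Q.ψ Q.ψcp Q.ψc
  have hn : ∀ x, ‖ι x‖ = ‖x‖ := fun x => NonUnitalStarAlgHom.norm_map ι hι x
  have hφ : ∀ x, ‖ι (Q.φ x)‖ ≤ ‖x‖ := fun x => (hn _).le.trans (Q.φc x)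
  refine ⟨{ F := Q.F, inst := Q.inst, fin := Q.fin, ψ := θ ∘ₗ compr k, φ := (ι : B →ₗ[ℂ] A) ∘ₗ Q.φ
            ψcp := IsCP.comp' hθ (isCP_compr k hk)
            ψc := fun a => ?_
            φcp := IsCP.comp' (isCP_starHom ι) Q.φcp
            φc := hφ
            oz := fun x y hx hy hxy => ?_ }, ((ι : B →ₗ[ℂ] A) ∘ₗ Q.φ) ∘ₗ θ,
      fun a => (hφ _).trans (hθc a), fun a => rfl, fun b => ?_⟩
  · refine (hθc _).trans ?_
    rw [compr_apply]
    calc _ ≤ ‖k‖ * (‖a‖ * ‖k‖) :=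
          (norm_mul_le _ _).trans (mul_le_mul_of_nonneg_left (norm_mul_le _ _) (norm_nonneg _))
      _ ≤ 1 * (‖a‖ * 1) := by gcongr
      _ = ‖a‖ := by ring
  · change ι (Q.φ x) * ι (Q.φ y) = 0
    rw [← map_mul, Q.oz x y hx hy hxy, map_zero]
  · change ι (Q.φ (θ (ι b))) = ι (Q.φ (Q.ψ b))
    rw [hθe]

lemma PD.half {A : Type u} {B : Type v} [CStarAlgebra A] [CStarAlgebra B] {m : ℕ} (hB : PD m B)
    (ι : B →⋆ₙₐ[ℂ] A) (hι : Function.Injective ι) (k : A) (hk : star k = k) (hk1 : ‖k‖ ≤ 1)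
    (X : Finset A) (δ η : ℝ) (hη : 0 < η)
    (hX : ∀ x ∈ X, ∃ b, ‖k * (x * k) - ι b‖ ≤ δ) :
    ∃ P : Fin m → NPiece A, ∀ x ∈ X,
      ‖∑ i, (P i).app x - k * (x * k)‖ ≤ (m + 1) * δ + η := by
  classical
  choose! b hb using hX
  obtain ⟨Q, hQ⟩ := hB (X.image b) η hη
  choose P L hL hPL hLι using fun i => NPiece.push ι hι k hk hk1 (Q i)
  have hn : ∀ x, ‖ι x‖ = ‖x‖ := fun x => NonUnitalStarAlgHom.norm_map ι hι x
  refine ⟨P, fun x hx => ?_⟩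
  set y := k * (x * k) with hy
  have e1 : ∑ i, (P i).app x - y
      = ∑ i, L i (y - ι (b x)) + ι (∑ i, (Q i).app (b x) - b x) - (y - ι (b x)) := by
    simp only [map_sub, hLι, Finset.sum_sub_distrib, map_sum, hPL]
    rw [← hy]; abel
  have e2 : ‖∑ i, L i (y - ι (b x))‖ ≤ m * δ := by
    refine (norm_sum_le _ _).trans ?_
    refine (Finset.sum_le_card_nsmul _ _ δ fun i _ => (hL i _).trans (hb x hx)).trans ?_
    simp
  have e3 : ‖ι (∑ i, (Q i).app (b x) - b x)‖ ≤ η := by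
    rw [hn]; exact (hQ _ (Finset.mem_image_of_mem b hx)).le
  rw [e1]
  calc _ ≤ ‖∑ i, L i (y - ι (b x))‖ + ‖ι (∑ i, (Q i).app (b x) - b x)‖ + ‖y - ι (b x)‖ :=
        (norm_sub_le _ _).trans (by gcongr; exact norm_add_le _ _)
    _ ≤ m * δ + η + δ := by gcongr; exact hb x hx
    _ = _ := by ring

lemma subIso_hom {A B : Type u} [CStarAlgebra A] [CStarAlgebra B]
    {S : NonUnitalStarSubalgebra ℂ A} (h : SubIso S B) :
    ∃ ι : B →⋆ₙₐ[ℂ] A, Function.Injective ι ∧ ∀ s ∈ S, ∃ b, ι b = s := by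
  obtain ⟨e⟩ := h
  let e' : B →⋆ₙₐ[ℂ] S :=
    { toFun := e.symm, map_add' := map_add e.symm, map_mul' := map_mul e.symm,
      map_zero' := map_zero e.symm, map_smul' := fun c x => map_smul e.symm c x,
      map_star' := map_star e.symm }
  refine ⟨(NonUnitalStarSubalgebraClass.subtype S).comp e',
    Subtype.val_injective.comp e.symm.injective, fun s hs => ⟨e ⟨s, hs⟩, ?_⟩⟩
  change ((e.symm (e ⟨s, hs⟩) : S) : A) = s
  simp

lemma PD.step {A : Type u} [CStarAlgebra A] {m : ℕ}
    {𝒞 : NonUnitalStarSubalgebra ℂ A → Prop} (hA : WeakDecomposes A 𝒞)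
    (hC : ∀ S, 𝒞 S → ∃ (B : Type u) (_ : CStarAlgebra B), PD m B ∧ SubIso S B) :
    PD (m + m) A := by
  intro X ε hε
  set δ := ε / (4 * (m + 1)) / 4 with hδ
  have hδp : 0 < δ := by positivity
  let M : ℝ := ∑ x ∈ X, ‖x‖
  have hM : ∀ x ∈ X, ‖x‖ ≤ M := fun x hx =>
    Finset.single_le_sum (f := fun x : A => ‖x‖) (fun _ _ => norm_nonneg _) hx
  have hM0 : 0 ≤ M := Finset.sum_nonneg fun _ _ => norm_nonneg _
  obtain ⟨γ, hγ, hsq⟩ := sqrt_comm_aux A M δ hM0 hδp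
  obtain ⟨C, D, hCC, hCD, h, hpos, hh, hcomm, hXC, hXD⟩ := hA X (min γ δ) (by positivity)
  obtain ⟨B₁, i₁, hB₁, hS₁⟩ := hC C hCC
  obtain ⟨B₂, i₂, hB₂, hS₂⟩ := hC D hCD
  obtain ⟨ι₁, hι₁, hr₁⟩ := subIso_hom hS₁
  obtain ⟨ι₂, hι₂, hr₂⟩ := subIso_hom hS₂
  have hpos' : (∃ y : A, 1 - h = star y * y) ∧ ‖1 - h‖ ≤ 1 := by
    let _ := CStarAlgebra.spectralOrder A
    have _ := CStarAlgebra.spectralOrderedRing A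
    have h0 : 0 ≤ h := by obtain ⟨y, rfl⟩ := hpos; exact star_mul_self_nonneg y
    have hle : h ≤ 1 := (CStarAlgebra.norm_le_one_iff_of_nonneg h h0).1 hh
    have h1 : 0 ≤ 1 - h := sub_nonneg.2 hle
    exact ⟨CStarAlgebra.nonneg_iff_eq_star_mul_self.1 h1,
      (CStarAlgebra.norm_le_one_iff_of_nonneg _ h1).2 (sub_le_self _ h0)⟩
  obtain ⟨k₁, hk₁, hkk₁, hkn₁, hkc₁⟩ := hsq h hpos hh
  obtain ⟨k₂, hk₂, hkk₂, hkn₂, hkc₂⟩ := hsq (1 - h) hpos'.1 hpos'.2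
  have near : ∀ k g x : A, k * k = g → ‖k‖ ≤ 1 → ‖k * x - x * k‖ < δ →
      ‖k * (x * k) - g * x‖ ≤ δ := by
    intro k g x hk hkn hc
    have : k * (x * k) - g * x = - (k * (k * x - x * k)) := by rw [← hk]; noncomm_ring
    rw [this, norm_neg]
    calc _ ≤ ‖k‖ * ‖k * x - x * k‖ := norm_mul_le _ _
      _ ≤ 1 * δ := by gcongr
      _ = δ := one_mul _
  have n₁ : ∀ x ∈ X, ‖k₁ * (x * k₁) - h * x‖ ≤ δ := fun x hx => near _ _ _ hkk₁ hkn₁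
    (hkc₁ x (hM x hx) ((hcomm x hx).trans_le (min_le_left _ _)))
  have n₂ : ∀ x ∈ X, ‖k₂ * (x * k₂) - (1 - h) * x‖ ≤ δ := fun x hx => near _ _ _ hkk₂ hkn₂
    (hkc₂ x (hM x hx) (by
      have : (1 - h) * x - x * (1 - h) = -(h * x - x * h) := by noncomm_ring
      rw [this, norm_neg]
      exact (hcomm x hx).trans_le (min_le_left _ _)))
  have a₁ : ∀ x ∈ X, ∃ b, ‖k₁ * (x * k₁) - ι₁ b‖ ≤ 2 * δ := by
    intro x hx
    obtain ⟨s, hs, hxs⟩ := hXC x hx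
    obtain ⟨b, hb⟩ := hr₁ s hs
    refine ⟨b, ?_⟩
    rw [hb]
    have := norm_sub_le_norm_sub_add_norm_sub (k₁ * (x * k₁)) (h * x) s
    have := n₁ x hx
    have := hxs.le.trans (min_le_right _ _)
    linarith
  have a₂ : ∀ x ∈ X, ∃ b, ‖k₂ * (x * k₂) - ι₂ b‖ ≤ 2 * δ := by
    intro x hx
    obtain ⟨s, hs, hxs⟩ := hXD x hx
    obtain ⟨b, hb⟩ := hr₂ s hs
    refine ⟨b, ?_⟩
    rw [hb]
    have := norm_sub_le_norm_sub_add_norm_sub (k₂ * (x * k₂)) ((1 - h) * x) s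
    have := n₂ x hx
    have := hxs.le.trans (min_le_right _ _)
    linarith
  obtain ⟨P₁, hP₁⟩ := hB₁.half ι₁ hι₁ k₁ hk₁ hkn₁ X (2 * δ) δ hδp a₁
  obtain ⟨P₂, hP₂⟩ := hB₂.half ι₂ hι₂ k₂ hk₂ hkn₂ X (2 * δ) δ hδp a₂
  refine ⟨Fin.append P₁ P₂, fun x hx => ?_⟩
  rw [Fin.sum_univ_add]
  simp only [Fin.append_left, Fin.append_right]
  have e : ∑ i, (P₁ i).app x + ∑ i, (P₂ i).app x - x
      = ((∑ i, (P₁ i).app x - k₁ * (x * k₁)) + (k₁ * (x * k₁) - h * x))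
        + ((∑ i, (P₂ i).app x - k₂ * (x * k₂)) + (k₂ * (x * k₂) - (1 - h) * x)) := by
    rw [sub_mul, one_mul]; abel
  rw [e]
  have hm : (m + 1) * δ = ε / 16 := by rw [hδ]; field_simp; norm_num
  have hm0 : (0:ℝ) ≤ m := Nat.cast_nonneg m
  have hδ2 : δ ≤ ε / 16 := by nlinarith
  refine (norm_add_le _ _).trans_lt ?_
  have t₁ := (norm_add_le (∑ i, (P₁ i).app x - k₁ * (x * k₁)) (k₁ * (x * k₁) - h * x))
  have t₂ := (norm_add_le (∑ i, (P₂ i).app x - k₂ * (x * k₂)) (k₂ * (x * k₂) - (1 - h) * x))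
  have := hP₁ x hx
  have := hP₂ x hx
  have := n₁ x hx
  have := n₂ x hx
  linarith

lemma PD_of_inWD (n : ℕ) : ∀ (A : Type u) [CStarAlgebra A], InWD (n : Ordinal.{u}) A →
    PD (2 ^ n) A := by
  induction n using Nat.strong_induction_on with
  | _ n ih =>
  intro A _ h
  rw [InWD] at h
  rcases h with ⟨h0, h⟩ | ⟨h0, h⟩
  · have : n = 0 := by exact_mod_cast h0
    subst this
    simpa using PD_of_isLocFinDim h
  · have hn : n ≠ 0 := by rintro rfl; simp at h0
    obtain ⟨k, rfl⟩ := Nat.exists_eq_succ_of_ne_zero hn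
    have := PD.step (m := 2 ^ k) h (by
      rintro S ⟨-, ⟨β, hβ⟩, B, instB, hB, hS⟩
      obtain ⟨j, rfl⟩ := Ordinal.lt_omega0.1 (hβ.trans (Ordinal.natCast_lt_omega0 _))
      have hj : j < k + 1 := by exact_mod_cast hβ
      exact ⟨B, instB, (ih j hj B hB).mono (Nat.pow_le_pow_right (by norm_num) (by omega)), hS⟩)
    rw [Nat.succ_eq_add_one, pow_succ, mul_two]
    exact this
end

/-- Proposition 2.19(i) of the paper.  For every natural number `n`, any
unital C*-algebra in the class `WD_n` has nuclear dimension at most `2ⁿ - 1`. -/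
theorem nuclearDim_of_inWD (n : ℕ) (A : Type u) [CStarAlgebra A]
    (h : InWD (n : Ordinal.{u}) A) :
    NuclearDimLE (2 ^ n - 1) A := by
  refine PD.nuclearDimLE ?_
  rw [Nat.sub_add_cancel Nat.one_le_two_pow]
  exact PD_of_inWD n A h
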